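/- There is a constant c such that for all integers n, r, s, t, k ≥ 1, the CNF SAT^{n,r} ∧ R^kREF^{n,r}_{s,t} (the propositional negation of the reflection principle for resolution, relativized k-fold) has a Res(2) refutation of size at most c·(t·r·n² + t·r² + t·r·n·k + s·t²·n³ + s·t²·n²·k + s·t²·n·k² + s·t³·n). -/

import Mathlib

open Classical Finset

structure Lit (V : Type) where
  var : V
  pos : Bool
deriving DecidableEq

abbrev Clause (V : Type) := Finset (Lit V)
abbrev PTerm (V : Type) := Finset (Lit V)
abbrev Cnf (V : Type) := Finset (Clause V)
abbrev Dnf (V : Type) := Finset (PTerm V)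

variable {V : Type} [DecidableEq V]

def Lit.neg (l : Lit V) : Lit V := ⟨l.var, !l.pos⟩

/-- A clause viewed as a 1-DNF. -/
def clauseToDnf (C : Clause V) : Dnf V := C.image (fun l => {l})

/-- A `k`-DNF: every term has at most `k` literals. -/
def IsKDnf (k : ℕ) (G : Dnf V) : Prop := ∀ q ∈ G, q.card ≤ k

/-- The inference rules of Res(k): axiom, weakening, ∧-introduction and cut. -/
inductive ResKInf (k : ℕ) : List (Dnf V) → Dnf V → Prop
  | ax (x : V) :
      ResKInf k [] {{(⟨x, true⟩ : Lit V)}, {(⟨x, false⟩ : Lit V)}}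
  | weaken (A B : Dnf V) : ResKInf k [A] (A ∪ B)
  | andIntro (A B : Dnf V) (l : Lit V) (q : PTerm V) (hq : q.card + 1 ≤ k) :
      ResKInf k [A ∪ {({l} : PTerm V)}, B ∪ {q}] (A ∪ B ∪ {insert l q})
  | cut (A B : Dnf V) (q : PTerm V) :
      ResKInf k [A ∪ {q}, B ∪ q.image (fun l => ({l.neg} : PTerm V))] (A ∪ B)

/-- A Res(k) refutation of the CNF `F`: a sequence of k-DNFs, each a clause of `F`
or inferred from earlier lines, ending with the empty clause. -/
def IsResKRefutation (k : ℕ) (F : Set (Clause V)) (P : List (Dnf V)) : Prop :=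
  P ≠ [] ∧ P.getLast? = some (∅ : Dnf V) ∧ (∀ G ∈ P, IsKDnf k G) ∧
  ∀ i : Fin P.length,
    (∃ C ∈ F, P.get i = clauseToDnf C) ∨
    ∃ prems : List (Dnf V), ResKInf k prems (P.get i) ∧
      ∀ Q ∈ prems, ∃ j : Fin P.length, (j : ℕ) < (i : ℕ) ∧ P.get j = Q

/-- The number of symbols in a DNF. -/
def dnfSize (G : Dnf V) : ℕ := ∑ q ∈ G, (q.card + 1)

/-- The size (number of symbols) of a Res(k) refutation. -/
def proofSize (P : List (Dnf V)) : ℕ := (P.map dnfSize).sum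

/-- The size (number of symbols) of a CNF. -/
def cnfSize (F : Cnf V) : ℕ := ∑ C ∈ F, (C.card + 1)

/-- The set of propositional variables occurring in a CNF. -/
def cnfVars (F : Cnf V) : Finset V := F.sup (fun C => C.image Lit.var)

def SatClauseA (a : V → Bool) (C : Clause V) : Prop := ∃ l ∈ C, a l.var = l.pos

/-- Unsatisfiability of a CNF. -/
def Unsat (F : Set (Clause V)) : Prop := ¬ ∃ a : V → Bool, ∀ C ∈ F, SatClauseA a C

def litSatP (π : V → Option Bool) (l : Lit V) : Prop := π l.var = some l.pos
def litFalsP (π : V → Option Bool) (l : Lit V) : Prop := π l.var = some (!l.pos)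

/-- A partial assignment satisfies a term if it satisfies all its literals. -/
def satPTerm (π : V → Option Bool) (q : PTerm V) : Prop := ∀ l ∈ q, litSatP π l
/-- A partial assignment falsifies a term if it falsifies some literal of it. -/
def falsPTerm (π : V → Option Bool) (q : PTerm V) : Prop := ∃ l ∈ q, litFalsP π l

/-- The restriction of a DNF by a partial assignment: falsified terms are removed,
and satisfied literals are removed from the remaining terms. -/
noncomputable def restrictDnf (G : Dnf V) (π : V → Option Bool) : Dnf V :=
  (G.filter (fun q => ¬ falsPTerm π q)).image (fun q => q.filter (fun l => ¬ litSatP π l))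

def clauseSatP (π : V → Option Bool) (C : Clause V) : Prop := ∃ l ∈ C, litSatP π l

/-- The restriction of a clause: falsified literals are removed. -/
noncomputable def restrictClause (C : Clause V) (π : V → Option Bool) : Clause V :=
  C.filter (fun l => ¬ litFalsP π l)

/-- The restriction of a CNF by a partial assignment: satisfied clauses are removed,
falsified literals are removed from the remaining clauses. -/
def restrictCnfSet (F : Set (Clause V)) (π : V → Option Bool) : Set (Clause V) :=
  {E | ∃ C ∈ F, ¬ clauseSatP π C ∧ E = restrictClause C π}

/-- A resolution refutation of the CNF `F` (weakening is built into the rules). -/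
def IsResRefutation (F : Set (Clause V)) (P : List (Clause V)) : Prop :=
  P ≠ [] ∧ P.getLast? = some (∅ : Clause V) ∧
  ∀ i : Fin P.length,
    (∃ C ∈ F, C ⊆ P.get i) ∨
    ∃ jv jw : Fin P.length, (jv : ℕ) < (i : ℕ) ∧ (jw : ℕ) < (i : ℕ) ∧ ∃ x : V,
      (⟨x, true⟩ : Lit V) ∈ P.get jv ∧ (⟨x, false⟩ : Lit V) ∈ P.get jw ∧
      ((P.get jv).erase ⟨x, true⟩ ∪ (P.get jw).erase ⟨x, false⟩) ⊆ P.get i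

/-- The variables of `SAT^{n,r} ∧ R^kREF^{n,r}_{s,t}`. -/
inductive PfVar : Type
  | C (m ℓ : ℕ) (b : Bool)
  | T (ℓ : ℕ)
  | Tc (m ℓ : ℕ) (b : Bool)
  | D (i j ℓ : ℕ) (b : Bool)
  | L (i j j' : ℕ)
  | R (i j j' : ℕ)
  | V (i j ℓ : ℕ)
  | I (j m : ℕ)
  | S (u i j : ℕ)
deriving DecidableEq

/-- The clauses of `SAT^{n,r}`. -/
inductive SatClause (n r : ℕ) : Clause PfVar → Prop
  | bigT {m : ℕ} (hm : m ∈ Finset.Icc 1 r) :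
      SatClause n r
        ((Finset.Icc 1 n ×ˢ ({true, false} : Finset Bool)).image
          (fun p => (⟨.Tc m p.1 p.2, true⟩ : Lit PfVar)))
  | posT {m ℓ : ℕ} (hm : m ∈ Finset.Icc 1 r) (hℓ : ℓ ∈ Finset.Icc 1 n) :
      SatClause n r {⟨.Tc m ℓ true, false⟩, ⟨.T ℓ, true⟩}
  | negT {m ℓ : ℕ} (hm : m ∈ Finset.Icc 1 r) (hℓ : ℓ ∈ Finset.Icc 1 n) :
      SatClause n r {⟨.Tc m ℓ false, false⟩, ⟨.T ℓ, false⟩}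
  | inC {m ℓ : ℕ} {b : Bool} (hm : m ∈ Finset.Icc 1 r) (hℓ : ℓ ∈ Finset.Icc 1 n) :
      SatClause n r {⟨.Tc m ℓ b, false⟩, ⟨.C m ℓ b, true⟩}

/-- The disjunction `⋁_{u ∈ [k]} ¬S_u(i,j)`. -/
def SnegPf (k i j : ℕ) : Clause PfVar :=
  (Finset.Icc 1 k).image (fun u => (⟨.S u i j, false⟩ : Lit PfVar))

/-- The clauses of `R^kREF^{n,r}_{s,t}`. -/
inductive RRefNRClause (n r s t k : ℕ) : Clause PfVar → Prop
  | ax {j m ℓ : ℕ} {b : Bool} (hj : j ∈ Finset.Icc 1 t) (hm : m ∈ Finset.Icc 1 r)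
      (hℓ : ℓ ∈ Finset.Icc 1 n) :
      RRefNRClause n r s t k
        (SnegPf k 1 j ∪ {⟨.I j m, false⟩, ⟨.C m ℓ b, false⟩, ⟨.D 1 j ℓ b, true⟩})
  | nontaut {i j ℓ : ℕ} (hi : i ∈ Finset.Icc 1 s) (hj : j ∈ Finset.Icc 1 t)
      (hℓ : ℓ ∈ Finset.Icc 1 n) :
      RRefNRClause n r s t k
        (SnegPf k i j ∪ {⟨.D i j ℓ true, false⟩, ⟨.D i j ℓ false, false⟩})
  | lcut {i j j' ℓ : ℕ} (hi : i ∈ Finset.Icc 2 s) (hj : j ∈ Finset.Icc 1 t)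
      (hj' : j' ∈ Finset.Icc 1 t) (hℓ : ℓ ∈ Finset.Icc 1 n) :
      RRefNRClause n r s t k
        (SnegPf k i j ∪ {⟨.L i j j', false⟩, ⟨.V i j ℓ, false⟩, ⟨.D (i-1) j' ℓ true, true⟩})
  | rcut {i j j' ℓ : ℕ} (hi : i ∈ Finset.Icc 2 s) (hj : j ∈ Finset.Icc 1 t)
      (hj' : j' ∈ Finset.Icc 1 t) (hℓ : ℓ ∈ Finset.Icc 1 n) :
      RRefNRClause n r s t k
        (SnegPf k i j ∪ {⟨.R i j j', false⟩, ⟨.V i j ℓ, false⟩, ⟨.D (i-1) j' ℓ false, true⟩})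
  | ltransf {i j j' ℓ ℓ' : ℕ} {b : Bool} (hi : i ∈ Finset.Icc 2 s) (hj : j ∈ Finset.Icc 1 t)
      (hj' : j' ∈ Finset.Icc 1 t) (hℓ : ℓ ∈ Finset.Icc 1 n) (hℓ' : ℓ' ∈ Finset.Icc 1 n)
      (hne : (ℓ', b) ≠ (ℓ, true)) :
      RRefNRClause n r s t k
        (SnegPf k i j ∪ {⟨.L i j j', false⟩, ⟨.V i j ℓ, false⟩,
          ⟨.D (i-1) j' ℓ' b, false⟩, ⟨.D i j ℓ' b, true⟩})
  | rtransf {i j j' ℓ ℓ' : ℕ} {b : Bool} (hi : i ∈ Finset.Icc 2 s) (hj : j ∈ Finset.Icc 1 t)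
      (hj' : j' ∈ Finset.Icc 1 t) (hℓ : ℓ ∈ Finset.Icc 1 n) (hℓ' : ℓ' ∈ Finset.Icc 1 n)
      (hne : (ℓ', b) ≠ (ℓ, false)) :
      RRefNRClause n r s t k
        (SnegPf k i j ∪ {⟨.R i j j', false⟩, ⟨.V i j ℓ, false⟩,
          ⟨.D (i-1) j' ℓ' b, false⟩, ⟨.D i j ℓ' b, true⟩})
  | empty {ℓ : ℕ} {b : Bool} (hℓ : ℓ ∈ Finset.Icc 1 n) :
      RRefNRClause n r s t k (SnegPf k s t ∪ {⟨.D s t ℓ b, false⟩})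
  | vdom {i j : ℕ} (hi : i ∈ Finset.Icc 2 s) (hj : j ∈ Finset.Icc 1 t) :
      RRefNRClause n r s t k
        (SnegPf k i j ∪ (Finset.Icc 1 n).image (fun ℓ => (⟨.V i j ℓ, true⟩ : Lit PfVar)))
  | idom {j : ℕ} (hj : j ∈ Finset.Icc 1 t) :
      RRefNRClause n r s t k
        (SnegPf k 1 j ∪ (Finset.Icc 1 r).image (fun m => (⟨.I j m, true⟩ : Lit PfVar)))
  | ldom {i j : ℕ} (hi : i ∈ Finset.Icc 2 s) (hj : j ∈ Finset.Icc 1 t) :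
      RRefNRClause n r s t k
        (SnegPf k i j ∪ (Finset.Icc 1 t).image (fun j' => (⟨.L i j j', true⟩ : Lit PfVar)))
  | rdom {i j : ℕ} (hi : i ∈ Finset.Icc 2 s) (hj : j ∈ Finset.Icc 1 t) :
      RRefNRClause n r s t k
        (SnegPf k i j ∪ (Finset.Icc 1 t).image (fun j' => (⟨.R i j j', true⟩ : Lit PfVar)))
  | vfunc {i j ℓ ℓ' : ℕ} (hi : i ∈ Finset.Icc 2 s) (hj : j ∈ Finset.Icc 1 t)
      (hℓ : ℓ ∈ Finset.Icc 1 n) (hℓ' : ℓ' ∈ Finset.Icc 1 n) (hne : ℓ ≠ ℓ') :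
      RRefNRClause n r s t k (SnegPf k i j ∪ {⟨.V i j ℓ, false⟩, ⟨.V i j ℓ', false⟩})
  | ifunc {j m m' : ℕ} (hj : j ∈ Finset.Icc 1 t) (hm : m ∈ Finset.Icc 1 r)
      (hm' : m' ∈ Finset.Icc 1 r) (hne : m ≠ m') :
      RRefNRClause n r s t k (SnegPf k 1 j ∪ {⟨.I j m, false⟩, ⟨.I j m', false⟩})
  | lfunc {i j j' j'' : ℕ} (hi : i ∈ Finset.Icc 2 s) (hj : j ∈ Finset.Icc 1 t)
      (hj' : j' ∈ Finset.Icc 1 t) (hj'' : j'' ∈ Finset.Icc 1 t) (hne : j' ≠ j'') :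
      RRefNRClause n r s t k (SnegPf k i j ∪ {⟨.L i j j', false⟩, ⟨.L i j j'', false⟩})
  | rfunc {i j j' j'' : ℕ} (hi : i ∈ Finset.Icc 2 s) (hj : j ∈ Finset.Icc 1 t)
      (hj' : j' ∈ Finset.Icc 1 t) (hj'' : j'' ∈ Finset.Icc 1 t) (hne : j' ≠ j'') :
      RRefNRClause n r s t k (SnegPf k i j ∪ {⟨.R i j j', false⟩, ⟨.R i j j'', false⟩})
  | sTrue {u : ℕ} (hu : u ∈ Finset.Icc 1 k) :
      RRefNRClause n r s t k {⟨.S u s t, true⟩}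
  | lUnused {i j j' u' : ℕ} (hi : i ∈ Finset.Icc 2 s) (hj : j ∈ Finset.Icc 1 t)
      (hj' : j' ∈ Finset.Icc 1 t) (hu' : u' ∈ Finset.Icc 1 k) :
      RRefNRClause n r s t k
        (SnegPf k i j ∪ {⟨.L i j j', false⟩, ⟨.S u' (i-1) j', true⟩})
  | rUnused {i j j' u' : ℕ} (hi : i ∈ Finset.Icc 2 s) (hj : j ∈ Finset.Icc 1 t)
      (hj' : j' ∈ Finset.Icc 1 t) (hu' : u' ∈ Finset.Icc 1 k) :
      RRefNRClause n r s t k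
        (SnegPf k i j ∪ {⟨.R i j j', false⟩, ⟨.S u' (i-1) j', true⟩})

/-- A list of lines derived in `Res(2)` from the clauses of `F` and the premises `Γ`, with the
newest line at the head. -/
inductive Res2Derivation (F : Set (Clause V)) (Γ : Set (Dnf V)) : List (Dnf V) → Prop
  | nil : Res2Derivation F Γ []
  | cons {G : Dnf V} {P : List (Dnf V)} (hP : Res2Derivation F Γ P) (hG : IsKDnf 2 G)
      (h : (∃ C ∈ F, G = clauseToDnf C) ∨
        ∃ prems, ResKInf 2 prems G ∧ ∀ Q ∈ prems, Q ∈ P ∨ Q ∈ Γ) :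
      Res2Derivation F Γ (G :: P)

/-- `G` is derivable in `Res(2)` from `F` and the lines `Γ` with size at most `N`. -/
def Res2Derivable (F : Set (Clause V)) (Γ : Set (Dnf V)) (G : Dnf V) (N : ℕ) : Prop :=
  ∃ P, Res2Derivation F Γ (G :: P) ∧ proofSize (G :: P) ≤ N

/-- The disjunction of the negated literals of a term. -/
def negTerm (q : PTerm V) : Dnf V := q.image (fun l => ({l.neg} : PTerm V))

/-- `G` can be a line of a `Res(2)` derivation and has size at most `w`. -/
def IsLine {W : Type} (w : ℕ) (G : Dnf W) : Prop := IsKDnf 2 G ∧ dnfSize G ≤ w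

section Generic

variable {F : Set (Clause V)} {Γ Δ : Set (Dnf V)} {G H : Dnf V} {N M w : ℕ}

theorem proofSize_cons {W : Type} (G : Dnf W) (P : List (Dnf W)) :
    proofSize (G :: P) = dnfSize G + proofSize P := by
  simp [proofSize]

theorem proofSize_append {W : Type} (P Q : List (Dnf W)) :
    proofSize (P ++ Q) = proofSize P + proofSize Q := by
  simp [proofSize]

theorem proofSize_reverse {W : Type} (P : List (Dnf W)) : proofSize P.reverse = proofSize P := by
  simp [proofSize, List.sum_reverse]

theorem dnfSize_mono {W : Type} {G H : Dnf W} (h : G ⊆ H) : dnfSize G ≤ dnfSize H :=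
  Finset.sum_le_sum_of_subset h

theorem dnfSize_union_le (G H : Dnf V) : dnfSize (G ∪ H) ≤ dnfSize G + dnfSize H := by
  have := Finset.sum_union_inter (s₁ := G) (s₂ := H) (f := fun q : PTerm V => q.card + 1)
  unfold dnfSize
  omega

theorem dnfSize_image_le {ι : Type} [DecidableEq ι] (U : Finset ι) (f : ι → PTerm V) (c : ℕ)
    (h : ∀ x ∈ U, (f x).card ≤ c) : dnfSize (U.image f) ≤ U.card * (c + 1) := by
  unfold dnfSize
  calc _ ≤ (U.image f).card * (c + 1) := by
        apply Finset.sum_le_card_nsmul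
        intro q hq
        obtain ⟨x, hx, rfl⟩ := Finset.mem_image.1 hq
        exact Nat.succ_le_succ (h x hx)
    _ ≤ _ := Nat.mul_le_mul_right _ Finset.card_image_le

theorem dnfSize_negTerm_le (q : PTerm V) : dnfSize (negTerm q) ≤ q.card * 2 :=
  dnfSize_image_le q _ 1 (by simp)

theorem isKDnf_union {k : ℕ} : IsKDnf k (G ∪ H) ↔ IsKDnf k G ∧ IsKDnf k H := by
  simp only [IsKDnf, Finset.mem_union]
  grind

theorem isKDnf_singleton {W : Type} {k : ℕ} (q : PTerm W) : IsKDnf k {q} ↔ q.card ≤ k := by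
  simp [IsKDnf]

theorem isKDnf_image {ι : Type} [DecidableEq ι] {k : ℕ} (U : Finset ι) (f : ι → PTerm V)
    (h : ∀ x ∈ U, (f x).card ≤ k) : IsKDnf k (U.image f) := by
  intro q hq
  obtain ⟨x, hx, rfl⟩ := Finset.mem_image.1 hq
  exact h x hx

theorem isKDnf_negTerm (q : PTerm V) : IsKDnf 2 (negTerm q) :=
  isKDnf_image q _ (by simp)

theorem IsKDnf.subset {W : Type} {G H : Dnf W} {k : ℕ} (h : IsKDnf k H) (hG : G ⊆ H) : IsKDnf k G :=
  fun q hq => h q (hG hq)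

theorem IsLine.mono {W : Type} {G : Dnf W} (h : IsLine N G) (hNM : N ≤ M) : IsLine M G :=
  ⟨h.1, h.2.trans hNM⟩

theorem IsLine.union (hG : IsLine N G) (hH : IsLine M H) : IsLine (N + M) (G ∪ H) :=
  ⟨isKDnf_union.2 ⟨hG.1, hH.1⟩, (dnfSize_union_le G H).trans (add_le_add hG.2 hH.2)⟩

theorem IsLine.insertLit (hG : IsLine N G) (l : Lit V) : IsLine (N + 2) (G ∪ {{l}}) :=
  hG.union ⟨by simp [isKDnf_singleton], by simp [dnfSize]⟩

theorem isLine_image {ι : Type} [DecidableEq ι] (U : Finset ι) (f : ι → PTerm V) (c : ℕ)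
    (hc : c ≤ 2) (h : ∀ x ∈ U, (f x).card ≤ c) : IsLine (U.card * (c + 1)) (U.image f) :=
  ⟨isKDnf_image U f fun x hx => (h x hx).trans hc, dnfSize_image_le U f c h⟩

theorem Res2Derivation.append {P Q : List (Dnf V)} (hP : Res2Derivation F Γ P)
    (hQ : Res2Derivation F Δ Q)
    (h : ∀ G ∈ Δ, G ∈ P ∨ G ∈ Γ) : Res2Derivation F Γ (Q ++ P) := by
  induction hQ with
  | nil => exact hP
  | cons _ hG hstep ih =>
    refine .cons ih hG ?_
    rcases hstep with hC | ⟨prems, hinf, hprems⟩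
    · exact .inl hC
    · refine .inr ⟨prems, hinf, fun R hR => ?_⟩
      rcases hprems R hR with hR | hR
      · exact .inl (List.mem_append_left _ hR)
      · exact (h R hR).imp (List.mem_append_right _) id

theorem Res2Derivation.isKDnf {P : List (Dnf V)} (hP : Res2Derivation F Γ P) : ∀ G ∈ P, IsKDnf 2 G := by
  induction hP with
  | nil => simp
  | cons _ hG _ ih => simpa using ⟨hG, ih⟩

theorem Res2Derivation.reverse_step {P : List (Dnf V)} (hP : Res2Derivation F ∅ P) (i : ℕ)
    (hi : i < P.reverse.length) :
    (∃ C ∈ F, P.reverse[i] = clauseToDnf C) ∨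
      ∃ prems, ResKInf 2 prems P.reverse[i] ∧ ∀ Q ∈ prems, Q ∈ P.reverse.take i := by
  induction hP with
  | nil => simp at hi
  | @cons G P _ _ hstep ih =>
    rcases Nat.lt_or_ge i P.reverse.length with hlt | hge
    · simpa [List.getElem_append_left hlt, List.take_append_of_le_length hlt.le] using ih hlt
    · have hi' : i = P.reverse.length := by simp at hi hge ⊢; omega
      subst hi'
      simpa using hstep

theorem Res2Derivable.isResKRefutation (h : Res2Derivable F ∅ ∅ N) :
    ∃ P : List (Dnf V), IsResKRefutation 2 F P ∧ proofSize P ≤ N := by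
  obtain ⟨P, hP, hN⟩ := h
  refine ⟨(∅ :: P).reverse, ⟨by simp, by simp, ?_, fun i => ?_⟩, by rwa [proofSize_reverse]⟩
  · intro G hG
    exact hP.isKDnf G (List.mem_reverse.1 hG)
  · refine (hP.reverse_step i i.2).imp id ?_
    rintro ⟨prems, hinf, hprems⟩
    refine ⟨prems, hinf, fun Q hQ => ?_⟩
    obtain ⟨j, hj, rfl⟩ := List.mem_take_iff_getElem.1 (hprems Q hQ)
    exact ⟨⟨j, by omega⟩, by simp at hj ⊢; omega, rfl⟩

theorem Res2Derivable.mono (h : Res2Derivable F Γ G N) (hNM : N ≤ M) : Res2Derivable F Γ G M :=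
  let ⟨P, hP, hN⟩ := h
  ⟨P, hP, hN.trans hNM⟩

theorem Res2Derivable.isKDnf (h : Res2Derivable F Γ G N) : IsKDnf 2 G :=
  let ⟨_, hP, _⟩ := h
  hP.isKDnf G List.mem_cons_self

theorem Res2Derivable.infer_one (h : Res2Derivable F Γ H N) (hG : IsKDnf 2 G)
    (hinf : ResKInf 2 [H] G) :
    Res2Derivable F Γ G (N + dnfSize G) := by
  obtain ⟨P, hP, hN⟩ := h
  refine ⟨H :: P, .cons hP hG (.inr ⟨_, hinf, by simp⟩), ?_⟩
  rw [proofSize_cons]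
  omega

theorem Res2Derivable.infer_two {H' : Dnf V} (h : Res2Derivable F Γ H N) (h' : Res2Derivable F Γ H' M)
    (hG : IsKDnf 2 G) (hinf : ResKInf 2 [H, H'] G) :
    Res2Derivable F Γ G (N + M + dnfSize G) := by
  obtain ⟨P, hP, hN⟩ := h
  obtain ⟨Q, hQ, hM⟩ := h'
  refine ⟨H' :: Q ++ H :: P,
    .cons (hP.append hQ fun _ => Or.inr) hG (.inr ⟨_, hinf, by simp⟩), ?_⟩
  rw [proofSize_cons, proofSize_append]
  omega

theorem Res2Derivable.weaken (h : Res2Derivable F Γ H N) (hHG : H ⊆ G) (hG : IsKDnf 2 G) :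
    Res2Derivable F Γ G (N + dnfSize G) := by
  refine h.infer_one hG ?_
  have := ResKInf.weaken (k := 2) H G
  rwa [Finset.union_eq_right.2 hHG] at this

theorem Res2Derivable.of_clause {C : Clause V} (hC : C ∈ F) (hCG : clauseToDnf C ⊆ G)
    (hline : IsLine w G) : Res2Derivable F Γ G (2 * w) := by
  obtain ⟨hG, hw⟩ := hline
  have h : Res2Derivable F Γ (clauseToDnf C) (dnfSize (clauseToDnf C)) :=
    ⟨[], .cons .nil (hG.subset hCG) (.inl ⟨C, hC, rfl⟩), by simp [proofSize]⟩
  have := dnfSize_mono hCG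
  exact (h.weaken hCG hG).mono (by omega)

theorem Res2Derivable.of_mem (hH : H ∈ Γ) (hHG : H ⊆ G) (hline : IsLine w G) :
    Res2Derivable F Γ G w := by
  obtain ⟨hG, hw⟩ := hline
  refine ⟨[], .cons .nil hG (.inr ⟨[H], ?_, by simpa using hH⟩), by simpa [proofSize] using hw⟩
  have := ResKInf.weaken (k := 2) H G
  rwa [Finset.union_eq_right.2 hHG] at this

theorem Res2Derivable.of_literals (x : V) (b : Bool) (hx : {⟨x, b⟩} ∈ G) (hx' : {⟨x, !b⟩} ∈ G)
    (hline : IsLine w G) : Res2Derivable F Γ G (2 * w) := by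
  obtain ⟨hG, hw⟩ := hline
  have hsub : {{(⟨x, true⟩ : Lit V)}, {(⟨x, false⟩ : Lit V)}} ⊆ G := by
    cases b <;> simp_all [Finset.insert_subset_iff]
  have h : Res2Derivable F Γ {{(⟨x, true⟩ : Lit V)}, {(⟨x, false⟩ : Lit V)}}
      (dnfSize {{(⟨x, true⟩ : Lit V)}, {(⟨x, false⟩ : Lit V)}}) :=
    ⟨[], .cons .nil (hG.subset hsub) (.inr ⟨[], .ax x, by simp⟩), by simp [proofSize]⟩
  have := dnfSize_mono hsub
  exact (h.weaken hsub hG).mono (by omega)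

theorem Res2Derivable.cut (q : PTerm V) (h : Res2Derivable F Γ (G ∪ {q}) N)
    (h' : Res2Derivable F Γ (G ∪ negTerm q) M) (hline : IsLine w G) :
    Res2Derivable F Γ G (N + M + w) := by
  have hw := hline.2
  have hG := (isKDnf_union.1 h.isKDnf).1
  refine (h.infer_two h' hG ?_).mono (by omega)
  have := ResKInf.cut (k := 2) G G q
  rwa [Finset.union_self] at this

theorem Res2Derivable.andIntro (l l' : Lit V) (h : Res2Derivable F Γ (G ∪ {{l}}) N)
    (h' : Res2Derivable F Γ (G ∪ {{l'}}) M) (hl : {l, l'} ∈ G) (hline : IsLine w G) :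
    Res2Derivable F Γ G (N + M + w) := by
  have hw := hline.2
  have hG := (isKDnf_union.1 h.isKDnf).1
  refine (h.infer_two h' hG ?_).mono (by omega)
  have := ResKInf.andIntro (k := 2) G G l {l'} (by simp)
  rwa [Finset.union_self, Finset.union_eq_left.2 (Finset.singleton_subset_iff.2 hl)] at this

/-- Cut away, one after the other, all the terms `f x` with `x ∈ U`. -/
theorem Res2Derivable.cut_image {ι : Type} [DecidableEq ι] (U : Finset ι) (f : ι → PTerm V)
    (hf : ∀ x ∈ U, (f x).card ≤ 2)
    (h : Res2Derivable F Γ (G ∪ U.image f) N)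
    (hx : ∀ x ∈ U, Res2Derivable F Γ (G ∪ negTerm (f x)) M) (hline : IsLine w (G ∪ U.image f)) :
    Res2Derivable F Γ G (N + U.card * (M + 2 * w + 4)) := by
  obtain ⟨-, hw⟩ := hline
  induction U using Finset.induction_on generalizing N with
  | empty => simpa using h
  | @insert x U hxU ih =>
    have hsub : G ∪ U.image f ⊆ G ∪ (insert x U).image f :=
      Finset.union_subset_union_right (Finset.image_subset_image (Finset.subset_insert _ _))
    have hw' := (dnfSize_mono hsub).trans hw
    have hneg := dnfSize_negTerm_le (f x)
    have hcard := hf x (Finset.mem_insert_self _ _)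
    have hun := dnfSize_union_le (G ∪ U.image f) (negTerm (f x))
    have hcut : Res2Derivable F Γ (G ∪ U.image f) (N + (M + (w + 4)) + w) := by
      refine Res2Derivable.cut (f x) ?_ (((hx x (Finset.mem_insert_self _ _)).weaken
        (H := G ∪ negTerm (f x)) ?_ ?_).mono (by omega))
        ⟨h.isKDnf.subset hsub, hw'⟩
      · convert h using 1
        rw [Finset.image_insert, Finset.insert_eq, Finset.union_assoc,
          Finset.union_comm (U.image f)]
      · exact Finset.union_subset_union_left Finset.subset_union_left
      · exact isKDnf_union.2 ⟨h.isKDnf.subset hsub, isKDnf_negTerm _⟩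
    refine (ih (fun y hy => hf y (Finset.mem_insert_of_mem hy)) hcut
      (fun y hy => hx y (Finset.mem_insert_of_mem hy)) hw').mono (le_of_eq ?_)
    rw [Finset.card_insert_of_notMem hxU]
    ring

/-- Derivations of a family of lines can be put one after the other. -/
theorem Res2Derivation.exists_family {ι : Type} [DecidableEq ι] (U : Finset ι) (g : ι → Dnf V)
    {P : List (Dnf V)} (hP : Res2Derivation F ∅ P) (hΓ : ∀ G ∈ Γ, G ∈ P)
    (h : ∀ x ∈ U, Res2Derivable F Γ (g x) N) :
    ∃ Q, Res2Derivation F ∅ Q ∧ (∀ x ∈ U, g x ∈ Q) ∧ (∀ G ∈ Γ, G ∈ Q) ∧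
      proofSize Q ≤ proofSize P + U.card * N := by
  induction U using Finset.induction_on with
  | empty => exact ⟨P, hP, by simp, hΓ, by simp⟩
  | @insert x U hxU ih =>
    obtain ⟨Q, hQ, hmem, hΓQ, hsize⟩ := ih fun y hy => h y (Finset.mem_insert_of_mem hy)
    obtain ⟨R, hR, hRN⟩ := h x (Finset.mem_insert_self _ _)
    refine ⟨g x :: R ++ Q, hQ.append hR fun G hG => .inl (hΓQ G hG), ?_, ?_, ?_⟩
    · intro y hy
      rcases Finset.mem_insert.1 hy with rfl | hy
      · simp
      · exact List.mem_append_right _ (hmem y hy)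
    · exact fun G hG => List.mem_append_right _ (hΓQ G hG)
    · rw [proofSize_append, Finset.card_insert_of_notMem hxU]
      linarith

theorem clauseToDnf_union (C D : Clause V) :
    clauseToDnf (C ∪ D) = clauseToDnf C ∪ clauseToDnf D :=
  Finset.image_union _ _

theorem clauseToDnf_insert (l : Lit V) (C : Clause V) :
    clauseToDnf (insert l C) = insert {l} (clauseToDnf C) :=
  Finset.image_insert _ _ _

theorem clauseToDnf_singleton (l : Lit V) : clauseToDnf ({l} : Clause V) = {{l}} :=
  Finset.image_singleton _ _

theorem clauseToDnf_image {ι : Type} [DecidableEq ι] (U : Finset ι) (f : ι → Lit V) :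
    clauseToDnf (U.image f) = U.image fun x => {f x} := by
  rw [clauseToDnf, Finset.image_image]
  rfl

theorem negTerm_singleton (x : V) (b : Bool) : negTerm {(⟨x, b⟩ : Lit V)} = {{⟨x, !b⟩}} := by
  simp [negTerm, Lit.neg]

theorem negTerm_pair (x y : V) (b c : Bool) :
    negTerm {(⟨x, b⟩ : Lit V), ⟨y, c⟩} = {{⟨x, !b⟩}, {⟨y, !c⟩}} := by
  simp [negTerm, Lit.neg]

theorem isLine_clauseToDnf_image {ι : Type} [DecidableEq ι] (U : Finset ι) (f : ι → Lit V) :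
    IsLine (2 * U.card) (clauseToDnf (U.image f)) := by
  rw [clauseToDnf_image]
  exact (isLine_image U _ 1 (by norm_num) (by simp)).mono (by omega)

theorem Res2Derivable.cut_literals {ι : Type} [DecidableEq ι] (U : Finset ι) (f : ι → V) (b : Bool)
    (h : Res2Derivable F Γ (G ∪ clauseToDnf (U.image fun x => ⟨f x, b⟩)) N)
    (hx : ∀ x ∈ U, Res2Derivable F Γ (G ∪ {{⟨f x, !b⟩}}) M) (hline : IsLine w G) :
    Res2Derivable F Γ G (N + U.card * (M + 2 * (w + 2 * U.card) + 4)) := by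
  have hU := hline.union (isLine_clauseToDnf_image U fun x => ⟨f x, b⟩)
  rw [clauseToDnf_image] at h hU
  exact cut_image U _ (by simp) h (fun x hxU => by rw [negTerm_singleton]; exact hx x hxU) hU

end Generic

section Reflection

open Res2Derivable

/-- The clauses of `SAT^{n,r} ∧ R^kREF^{n,r}_{s,t}`. -/
def reflClauses (n r s t k : ℕ) : Set (Clause PfVar) :=
  {E | SatClause n r E} ∪ {E | RRefNRClause n r s t k E}

/-- Pairs `(ℓ, b)` standing for the literals `x_ℓ^b`. -/
def litIndices (n : ℕ) : Finset (ℕ × Bool) := Finset.Icc 1 n ×ˢ {true, false}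

/-- The literal `p` is in the clause `(i, j)` and is true. -/
def trueTerm (i j : ℕ) (p : ℕ × Bool) : PTerm PfVar := {⟨.D i j p.1 p.2, true⟩, ⟨.T p.1, p.2⟩}

/-- Some literal of the clause `(i, j)` is true. -/
def someTrue (n i j : ℕ) : Dnf PfVar := (litIndices n).image (trueTerm i j)

/-- The clause `(i, j)` is not used. -/
def unusedDnf (k i j : ℕ) : Dnf PfVar := clauseToDnf (SnegPf k i j)

/-- If the clause `(i, j)` is used, then it is true. -/
def truthLine (n k i j : ℕ) : Dnf PfVar := unusedDnf k i j ∪ someTrue n i j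

/-- The variable pointing to the left (`b = true`) or right (`b = false`) premise. -/
def premVar (b : Bool) (i j j' : ℕ) : PfVar := if b then .L i j j' else .R i j j'

variable {n r s t k i j j' ℓ ℓ' m : ℕ} {b b' : Bool} {Γ : Set (Dnf PfVar)}

theorem card_litIndices (n : ℕ) : (litIndices n).card = 2 * n := by
  simp [litIndices, mul_comm]

theorem card_trueTerm_le (i j : ℕ) (p : ℕ × Bool) : (trueTerm i j p).card ≤ 2 :=
  Finset.card_le_two

theorem isLine_someTrue (n i j : ℕ) : IsLine (6 * n) (someTrue n i j) :=
  (isLine_image (litIndices n) (trueTerm i j) 2 le_rfl fun p _ => card_trueTerm_le i j p).mono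
    (by rw [card_litIndices]; omega)

theorem isLine_unusedDnf (k i j : ℕ) : IsLine (2 * k) (unusedDnf k i j) :=
  (isLine_clauseToDnf_image _ _).mono (by simp)

theorem isLine_truthLine (n k i j : ℕ) : IsLine (2 * k + 6 * n) (truthLine n k i j) :=
  (isLine_unusedDnf k i j).union (isLine_someTrue n i j)

theorem trueTerm_mem_truthLine {p : ℕ × Bool} (hp : p ∈ litIndices n) :
    {⟨.D i j p.1 p.2, true⟩, ⟨.T p.1, p.2⟩} ∈ truthLine n k i j :=
  Finset.mem_union_right _ (Finset.mem_image_of_mem (trueTerm i j) hp)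

theorem mem_litIndices {p : ℕ × Bool} : p ∈ litIndices n ↔ p.1 ∈ Finset.Icc 1 n := by
  cases p with | mk a b => cases b <;> simp [litIndices]

theorem premVar_transfer_mem (hi : i ∈ Finset.Icc 2 s) (hj : j ∈ Finset.Icc 1 t)
    (hj' : j' ∈ Finset.Icc 1 t) (hℓ : ℓ ∈ Finset.Icc 1 n) (hℓ' : ℓ' ∈ Finset.Icc 1 n)
    (hne : (ℓ', b') ≠ (ℓ, b)) :
    SnegPf k i j ∪ {⟨premVar b i j j', false⟩, ⟨.V i j ℓ, false⟩,
      ⟨.D (i - 1) j' ℓ' b', false⟩, ⟨.D i j ℓ' b', true⟩} ∈ reflClauses n r s t k := by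
  cases b
  · exact .inr (.rtransf hi hj hj' hℓ hℓ' hne)
  · exact .inr (.ltransf hi hj hj' hℓ hℓ' hne)

theorem premVar_used_mem {u : ℕ} (b : Bool) (hi : i ∈ Finset.Icc 2 s) (hj : j ∈ Finset.Icc 1 t)
    (hj' : j' ∈ Finset.Icc 1 t) (hu : u ∈ Finset.Icc 1 k) :
    SnegPf k i j ∪ {⟨premVar b i j j', false⟩, ⟨.S u (i - 1) j', true⟩} ∈
      reflClauses n r s t k := by
  cases b
  · exact .inr (.rUnused hi hj hj' hu)
  · exact .inr (.lUnused hi hj hj' hu)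

theorem premVar_dom_mem (b : Bool) (hi : i ∈ Finset.Icc 2 s) (hj : j ∈ Finset.Icc 1 t) :
    SnegPf k i j ∪ (Finset.Icc 1 t).image (fun j' => (⟨premVar b i j j', true⟩ : Lit PfVar)) ∈
      reflClauses n r s t k := by
  cases b
  · exact .inr (.rdom hi hj)
  · exact .inr (.ldom hi hj)

theorem derivable_truthLine_of_axiom (hn : 1 ≤ n) (hk : 1 ≤ k) (hj : j ∈ Finset.Icc 1 t)
    (hm : m ∈ Finset.Icc 1 r) :
    Res2Derivable (reflClauses n r s t k) Γ (truthLine n k 1 j ∪ {{⟨.I j m, false⟩}})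
      (400 * (n * (n + k))) := by
  have hG := (isLine_truthLine n k 1 j).insertLit ⟨.I j m, false⟩
  refine Res2Derivable.mono (cut_literals (M := 8 * (2 * k + 6 * n + 2) + 40) (litIndices n)
    (fun p => .Tc m p.1 p.2) true
    (of_clause (.inl (.bigT hm)) Finset.subset_union_right
      (hG.union (isLine_clauseToDnf_image _ _))) ?_ hG) ?_
  · intro p hp
    have hℓ := mem_litIndices.1 hp
    have hG' := hG.insertLit ⟨.Tc m p.1 p.2, false⟩
    have hGD := hG'.insertLit ⟨.D 1 j p.1 p.2, true⟩
    refine Res2Derivable.mono (andIntro ⟨.D 1 j p.1 p.2, true⟩ ⟨.T p.1, p.2⟩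
      (cut (M := 2 * (2 * k + 6 * n + 8)) {⟨.C m p.1 p.2, true⟩}
        (of_clause (.inl (.inC (b := p.2) hm hℓ)) ?_ (hGD.insertLit _)) ?_ hGD)
      (w := 2 * k + 6 * n + 6) (M := 2 * (2 * k + 6 * n + 6)) ?_
      ?_ (hG'.mono (by omega))) ?_
    · intro q
      simp only [clauseToDnf_insert, clauseToDnf_singleton, Finset.mem_union, Finset.mem_insert,
        Finset.mem_singleton]
      tauto
    · rw [negTerm_singleton]
      refine of_clause (.inr (.ax (b := p.2) hj hm hℓ)) ?_ (hGD.insertLit _)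
      intro q
      simp only [clauseToDnf_union, clauseToDnf_insert, clauseToDnf_singleton, Finset.mem_union,
        Finset.mem_insert, Finset.mem_singleton, truthLine, unusedDnf, Bool.not_true]
      tauto
    · obtain ⟨a, _ | _⟩ := p
      · refine of_clause (.inl (.negT hm hℓ)) ?_ ((hG'.insertLit _).mono (by omega))
        intro q
        simp only [clauseToDnf_insert, clauseToDnf_singleton, Finset.mem_union, Finset.mem_insert,
          Finset.mem_singleton, Bool.not_true]
        tauto
      · refine of_clause (.inl (.posT hm hℓ)) ?_ ((hG'.insertLit _).mono (by omega))
        intro q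
        simp only [clauseToDnf_insert, clauseToDnf_singleton, Finset.mem_union, Finset.mem_insert,
          Finset.mem_singleton, Bool.not_true]
        tauto
    · exact Finset.mem_union_left _ (Finset.mem_union_left _ (trueTerm_mem_truthLine hp))
    · omega
  · rw [card_litIndices]
    nlinarith [Nat.mul_le_mul hn hn, Nat.mul_le_mul hn hk, Nat.mul_le_mul_left k hn,
      Nat.mul_le_mul_left n hn]

theorem derivable_truthLine_one (hn : 1 ≤ n) (hr : 1 ≤ r) (hk : 1 ≤ k)
    (hj : j ∈ Finset.Icc 1 t) :
    Res2Derivable (reflClauses n r s t k) Γ (truthLine n k 1 j)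
      (450 * (r * (n * (n + k) + r))) := by
  have hG := isLine_truthLine n k 1 j
  refine Res2Derivable.mono (cut_literals (Finset.Icc 1 r) (PfVar.I j) true
    (of_clause (.inr (.idom hj)) ?_ (hG.union (isLine_clauseToDnf_image _ _)))
    (fun m hm => derivable_truthLine_of_axiom hn hk hj hm) hG) ?_
  · rw [clauseToDnf_union]
    exact Finset.union_subset_union_left Finset.subset_union_left
  · rw [Nat.card_Icc, Nat.add_sub_cancel]
    have h1 : n + k ≤ n * (n + k) := Nat.le_mul_of_pos_left _ hn
    generalize n * (n + k) = x at *
    nlinarith [Nat.mul_le_mul_left r h1, Nat.mul_le_mul_right x hr, Nat.mul_le_mul_left r hr,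
      Nat.mul_le_mul_left r hn]

theorem derivable_truthLine_of_premise (hn : 1 ≤ n) (hk : 1 ≤ k) (b : Bool)
    (hi : i ∈ Finset.Icc 2 s) (hj : j ∈ Finset.Icc 1 t) (hj' : j' ∈ Finset.Icc 1 t)
    (hℓ : ℓ ∈ Finset.Icc 1 n) (hΓ : truthLine n k (i - 1) j' ∈ Γ) :
    Res2Derivable (reflClauses n r s t k) Γ
      (truthLine n k i j ∪ {{⟨.V i j ℓ, false⟩}} ∪ {{⟨.T ℓ, b⟩}} ∪
        {{⟨premVar b i j j', false⟩}})
      (200 * (n + k) ^ 2) := by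
  have hG := (((isLine_truthLine n k i j).insertLit ⟨.V i j ℓ, false⟩).insertLit
    ⟨.T ℓ, b⟩).insertLit ⟨premVar b i j j', false⟩
  have hT := hG.union (isLine_someTrue n (i - 1) j')
  refine Res2Derivable.mono (cut_image (M := 5 * (2 * k + 6 * n + 6) + 28) (litIndices n)
    (trueTerm (i - 1) j')
    (fun p _ => card_trueTerm_le _ _ p)
    (cut_literals (M := 2 * (2 * k + 12 * n + 8)) (Finset.Icc 1 k) (fun u => .S u (i - 1) j')
      false (of_mem hΓ ?_ (hT.union (isLine_unusedDnf k (i - 1) j'))) (fun u hu => ?_) hT)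
    (fun p hp => ?_) hT) ?_
  · intro q
    simp only [truthLine, Finset.mem_union, someTrue, unusedDnf, SnegPf]
    tauto
  · refine of_clause (premVar_used_mem b hi hj hj' hu) ?_
      ((hT.insertLit ⟨.S u (i - 1) j', true⟩).mono (by omega))
    intro q
    simp only [clauseToDnf_union, clauseToDnf_insert, clauseToDnf_singleton, Finset.mem_union,
      Finset.mem_insert, Finset.mem_singleton, truthLine, unusedDnf, Bool.not_false]
    tauto
  · have hneg : negTerm (trueTerm (i - 1) j' p) =
        {{⟨.D (i - 1) j' p.1 p.2, false⟩}} ∪ {{⟨.T p.1, !p.2⟩}} :=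
      negTerm_pair _ _ _ _
    rw [hneg, ← Finset.union_assoc]
    have hG' := (hG.insertLit ⟨.D (i - 1) j' p.1 p.2, false⟩).insertLit ⟨.T p.1, !p.2⟩
    by_cases hp' : p = (ℓ, b)
    · subst hp'
      exact Res2Derivable.mono (of_literals (.T ℓ) b (by simp) (by simp) hG') (by omega)
    · refine Res2Derivable.mono (andIntro ⟨.D i j p.1 p.2, true⟩ ⟨.T p.1, p.2⟩
        (of_clause (premVar_transfer_mem hi hj hj' hℓ (mem_litIndices.1 hp) hp') ?_
          (hG'.insertLit _))
        (of_literals (.T p.1) p.2 (by simp) (by simp) (hG'.insertLit _)) ?_ hG') (by omega)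
      · intro q
        simp only [clauseToDnf_union, clauseToDnf_insert, clauseToDnf_singleton,
          Finset.mem_union, Finset.mem_insert, Finset.mem_singleton, truthLine, unusedDnf]
        tauto
      · simp only [Finset.mem_union]
        exact .inl (.inl (.inl (.inl (.inl (trueTerm_mem_truthLine hp)))))
  · rw [card_litIndices, Nat.card_Icc, Nat.add_sub_cancel]
    nlinarith [Nat.mul_le_mul hn hn, Nat.mul_le_mul hk hk, Nat.mul_le_mul hn hk,
      Nat.mul_le_mul_left k hn, Nat.mul_le_mul_left n hn, Nat.mul_le_mul_left k hk]

theorem derivable_truthLine_of_pivot_value (hn : 1 ≤ n) (ht : 1 ≤ t) (hk : 1 ≤ k) (b : Bool)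
    (hi : i ∈ Finset.Icc 2 s) (hj : j ∈ Finset.Icc 1 t) (hℓ : ℓ ∈ Finset.Icc 1 n)
    (hΓ : ∀ j' ∈ Finset.Icc 1 t, truthLine n k (i - 1) j' ∈ Γ) :
    Res2Derivable (reflClauses n r s t k) Γ
      (truthLine n k i j ∪ {{⟨.V i j ℓ, false⟩}} ∪ {{⟨.T ℓ, b⟩}})
      (220 * (t * ((n + k) ^ 2 + t))) := by
  have hG := ((isLine_truthLine n k i j).insertLit ⟨.V i j ℓ, false⟩).insertLit ⟨.T ℓ, b⟩
  refine Res2Derivable.mono (cut_literals (Finset.Icc 1 t) (premVar b i j) true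
    (of_clause (premVar_dom_mem b hi hj) ?_ (hG.union (isLine_clauseToDnf_image _ _)))
    (fun j' hj' => derivable_truthLine_of_premise hn hk b hi hj hj' hℓ (hΓ j' hj')) hG) ?_
  · rw [clauseToDnf_union]
    refine Finset.union_subset_union_left ?_
    intro q
    simp only [truthLine, Finset.mem_union, unusedDnf]
    tauto
  · rw [Nat.card_Icc, Nat.add_sub_cancel]
    have h1 : 2 * (n + k) ≤ (n + k) ^ 2 := by nlinarith
    have h2 : 2 * k + 6 * n + 4 ≤ 4 * (n + k) ^ 2 := by omega
    have h3 : 4 ≤ (n + k) ^ 2 := by omega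
    generalize (n + k) ^ 2 = x at *
    nlinarith [Nat.mul_le_mul_left t h2, Nat.mul_le_mul_left t h3, Nat.mul_le_mul_right x ht,
      Nat.mul_le_mul_left t ht]

theorem derivable_truthLine_of_pivot (hn : 1 ≤ n) (ht : 1 ≤ t) (hk : 1 ≤ k)
    (hi : i ∈ Finset.Icc 2 s) (hj : j ∈ Finset.Icc 1 t) (hℓ : ℓ ∈ Finset.Icc 1 n)
    (hΓ : ∀ j' ∈ Finset.Icc 1 t, truthLine n k (i - 1) j' ∈ Γ) :
    Res2Derivable (reflClauses n r s t k) Γ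
      (truthLine n k i j ∪ {{⟨.V i j ℓ, false⟩}}) (450 * (t * ((n + k) ^ 2 + t))) := by
  refine Res2Derivable.mono (cut {⟨.T ℓ, true⟩}
    (derivable_truthLine_of_pivot_value hn ht hk true hi hj hℓ hΓ)
    (M := 220 * (t * ((n + k) ^ 2 + t))) ?_ ((isLine_truthLine n k i j).insertLit _)) ?_
  · rw [negTerm_singleton]
    exact derivable_truthLine_of_pivot_value hn ht hk false hi hj hℓ hΓ
  · have h1 : 2 * (n + k) ≤ (n + k) ^ 2 := by nlinarith
    have h2 : (n + k) ^ 2 + t ≤ t * ((n + k) ^ 2 + t) := Nat.le_mul_of_pos_left _ ht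
    omega

theorem derivable_truthLine_succ (hn : 1 ≤ n) (ht : 1 ≤ t) (hk : 1 ≤ k)
    (hi : i ∈ Finset.Icc 2 s) (hj : j ∈ Finset.Icc 1 t)
    (hΓ : ∀ j' ∈ Finset.Icc 1 t, truthLine n k (i - 1) j' ∈ Γ) :
    Res2Derivable (reflClauses n r s t k) Γ (truthLine n k i j)
      (500 * (n * (t * ((n + k) ^ 2 + t)))) := by
  have hG := isLine_truthLine n k i j
  refine Res2Derivable.mono (cut_literals (Finset.Icc 1 n) (PfVar.V i j) true
    (of_clause (.inr (.vdom hi hj)) ?_ (hG.union (isLine_clauseToDnf_image _ _)))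
    (fun ℓ hℓ => derivable_truthLine_of_pivot hn ht hk hi hj hℓ hΓ) hG) ?_
  · rw [clauseToDnf_union]
    exact Finset.union_subset_union_left Finset.subset_union_left
  · rw [Nat.card_Icc, Nat.add_sub_cancel]
    have h1 : 2 * (n + k) ≤ (n + k) ^ 2 := by nlinarith
    have h2 : (n + k) ^ 2 + t ≤ t * ((n + k) ^ 2 + t) := Nat.le_mul_of_pos_left _ ht
    have h3 : 2 * (n + k) + 1 ≤ t * ((n + k) ^ 2 + t) := by omega
    generalize t * ((n + k) ^ 2 + t) = x at *
    nlinarith [Nat.mul_le_mul_left n h3, Nat.mul_le_mul_right x hn]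

theorem derivable_empty (hn : 1 ≤ n) (hk : 1 ≤ k) (hΓ : truthLine n k s t ∈ Γ) :
    Res2Derivable (reflClauses n r s t k) Γ ∅ (100 * (n + k) ^ 2) := by
  have hU := isLine_unusedDnf k s t
  have hT := hU.union (isLine_someTrue n s t)
  have hcut : Res2Derivable (reflClauses n r s t k) Γ (unusedDnf k s t) _ :=
    cut_image (litIndices n) (trueTerm s t) (fun p _ => card_trueTerm_le _ _ p)
      (of_mem hΓ subset_rfl hT) (M := 2 * (2 * k + 2 + 2)) (fun p hp => by
        have hneg : negTerm (trueTerm s t p) =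
            {{⟨.D s t p.1 p.2, false⟩}} ∪ {{⟨.T p.1, !p.2⟩}} :=
          negTerm_pair _ _ _ _
        rw [hneg, ← Finset.union_assoc]
        refine of_clause (.inr (.empty (b := p.2) (mem_litIndices.1 hp))) ?_
          ((hU.insertLit _).insertLit _)
        rw [clauseToDnf_union, clauseToDnf_singleton]
        exact Finset.subset_union_left) hT
  rw [← Finset.empty_union (unusedDnf k s t)] at hcut
  refine Res2Derivable.mono (cut_literals (Finset.Icc 1 k) (fun u => .S u s t) false hcut
    (M := 4) (w := 0) (fun u hu => ?_) ⟨by simp [IsKDnf], by simp [dnfSize]⟩) ?_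
  · rw [Finset.empty_union]
    refine of_clause (w := 2) (.inr (.sTrue hu)) ?_ ⟨by simp [isKDnf_singleton], by simp [dnfSize]⟩
    rw [clauseToDnf_singleton]
    simp
  · rw [card_litIndices, Nat.card_Icc, Nat.add_sub_cancel]
    nlinarith [Nat.mul_le_mul hn hn, Nat.mul_le_mul hk hk, Nat.mul_le_mul hn hk,
      Nat.mul_le_mul_left k hn, Nat.mul_le_mul_left n hn, Nat.mul_le_mul_left k hk]

theorem exists_derivation_truthLine_level (hn : 1 ≤ n) (hr : 1 ≤ r) (ht : 1 ≤ t) (hk : 1 ≤ k)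
    (hi : i + 1 ≤ s) :
    ∃ P, Res2Derivation (reflClauses n r s t k) ∅ P ∧
      (∀ j ∈ Finset.Icc 1 t, truthLine n k (i + 1) j ∈ P) ∧
      proofSize P ≤ t * (450 * (r * (n * (n + k) + r))) +
        i * (t * (500 * (n * (t * ((n + k) ^ 2 + t))))) := by
  induction i with
  | zero =>
    obtain ⟨P, hP, hmem, -, hsize⟩ := Res2Derivation.exists_family (Γ := ∅) (Finset.Icc 1 t)
      (truthLine n k 1) .nil (by simp)
      fun j hj => derivable_truthLine_one (s := s) hn hr hk hj
    refine ⟨P, hP, hmem, hsize.trans (le_of_eq ?_)⟩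
    simp [proofSize]
  | succ i ih =>
    obtain ⟨P, hP, hmem, hsize⟩ := ih (by omega)
    obtain ⟨Q, hQ, hmemQ, -, hsizeQ⟩ := Res2Derivation.exists_family (Γ := {G | G ∈ P})
      (Finset.Icc 1 t) (truthLine n k (i + 1 + 1)) hP (fun _ => id)
      fun j hj => derivable_truthLine_succ hn ht hk
        (Finset.mem_Icc.2 ⟨by omega, hi⟩) hj hmem
    refine ⟨Q, hQ, hmemQ, hsizeQ.trans ?_⟩
    rw [Nat.card_Icc, Nat.add_sub_cancel]
    linarith

theorem derivable_empty_of_reflClauses (hn : 1 ≤ n) (hr : 1 ≤ r) (hs : 1 ≤ s) (ht : 1 ≤ t)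
    (hk : 1 ≤ k) :
    Res2Derivable (reflClauses n r s t k) ∅ ∅
      (t * (450 * (r * (n * (n + k) + r))) +
        s * (t * (500 * (n * (t * ((n + k) ^ 2 + t)))))) := by
  obtain ⟨i, rfl⟩ := Nat.exists_eq_add_of_le' hs
  obtain ⟨P, hP, hmem, hsize⟩ :=
    exists_derivation_truthLine_level (s := i + 1) hn hr ht hk le_rfl
  obtain ⟨Q, hQ, hsizeQ⟩ := derivable_empty (Γ := {G | G ∈ P}) (r := r) hn hk
    (hmem t (Finset.mem_Icc.2 ⟨ht, le_rfl⟩))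
  refine ⟨Q ++ P, hP.append hQ fun _ => Or.inl, ?_⟩
  rw [← List.cons_append, proofSize_append]
  have h : (n + k) ^ 2 + t ≤ t * (n * (t * ((n + k) ^ 2 + t))) :=
    (Nat.le_mul_of_pos_left _ ht).trans <|
      (Nat.le_mul_of_pos_left _ hn).trans (Nat.le_mul_of_pos_left _ ht)
  linarith

end Reflection

/-- There is a constant `c` such that for all `n, r, s, t, k ≥ 1` the CNF
`SAT^{n,r} ∧ R^kREF^{n,r}_{s,t}` has a Res(2) refutation of size at most
`c·(trn² + tr² + trnk + st²n³ + st²n²k + st²nk² + st³n)`. -/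
theorem reflection_res2_upper_bound :
    ∃ c : ℕ, 0 < c ∧
      ∀ n r s t k : ℕ, 1 ≤ n → 1 ≤ r → 1 ≤ s → 1 ≤ t → 1 ≤ k →
        ∃ P : List (Dnf PfVar),
          IsResKRefutation 2 ({E | SatClause n r E} ∪ {E | RRefNRClause n r s t k E}) P ∧
          proofSize P ≤
            c * (t*r*n^2 + t*r^2 + t*r*n*k + s*t^2*n^3 + s*t^2*n^2*k + s*t^2*n*k^2 + s*t^3*n) := by
  refine ⟨1000, by norm_num, fun n r s t k hn hr hs ht hk => ?_⟩
  obtain ⟨P, hP, hsize⟩ := (derivable_empty_of_reflClauses hn hr hs ht hk).isResKRefutation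
  refine ⟨P, hP, hsize.trans ?_⟩
  ring_nf
  omega
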